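/- Let μ and ν be Borel probability measures on ℝ with finite second moments, and define W(μ,ν) = (∫₀¹ (Q_μ(t) − Q_ν(t))² dt)^{1/2}, where Q_μ and Q_ν are the quantile functions of μ and ν. Then W(μ,ν) = 0 if and only if μ = ν. -/

import Mathlib

open MeasureTheory Set

/-- Cumulative distribution function of a measure on ℝ: `F_μ(x) = μ((−∞, x])`. -/
noncomputable def cdfFn (μ : Measure ℝ) (x : ℝ) : ℝ := (μ (Iic x)).toReal

/-- Quantile function of a measure on ℝ: `Q_μ(t) = inf {x | t ≤ F_μ(x)}`. -/
noncomputable def quantileFn (μ : Measure ℝ) (t : ℝ) : ℝ := sInf {x : ℝ | t ≤ cdfFn μ x}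

/-- The one-dimensional Wasserstein-2 distance between measures on ℝ, given in closed form
via quantile functions: `W(μ,ν) = (∫₀¹ (Q_μ(t) − Q_ν(t))² dt)^{1/2}`. -/
noncomputable def W2 (μ ν : Measure ℝ) : ℝ :=
  Real.sqrt (∫ t in Ioo (0 : ℝ) 1, (quantileFn μ t - quantileFn ν t) ^ 2)

open ProbabilityTheory Filter Topology in
/-- The Galois connection between the quantile function and the distribution function. -/
theorem quantileFn_le_iff (μ : Measure ℝ) [IsProbabilityMeasure μ] {t : ℝ}
    (ht : t ∈ Ioo (0 : ℝ) 1) (x : ℝ) : quantileFn μ t ≤ x ↔ t ≤ cdfFn μ x := by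
  have hF : cdfFn μ = cdf μ := funext fun y => (cdf_eq_real μ y).symm
  unfold quantileFn
  rw [hF]
  have hbdd : BddBelow {x : ℝ | t ≤ cdf μ x} := by
    obtain ⟨a, ha⟩ := ((tendsto_cdf_atBot μ).eventually_lt_const ht.1).exists
    refine ⟨a, fun y hy => ?_⟩
    by_contra! h
    exact absurd (hy.trans (monotone_cdf μ h.le)) ha.not_ge
  have hne : {x : ℝ | t ≤ cdf μ x}.Nonempty := by
    obtain ⟨b, hb⟩ := ((tendsto_cdf_atTop μ).eventually_const_lt ht.2).exists
    exact ⟨b, hb.le⟩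
  refine ⟨fun h => ?_, fun h => csInf_le hbdd h⟩
  have hlim : Tendsto (cdf μ) (𝓝[>] x) (𝓝 (cdf μ x)) :=
    ((cdf μ).right_continuous x).tendsto.mono_left (nhdsWithin_mono x Ioi_subset_Ici_self)
  refine ge_of_tendsto hlim ?_
  filter_upwards [self_mem_nhdsWithin] with y hy
  obtain ⟨z, hz, hzy⟩ := exists_lt_of_csInf_lt hne (h.trans_lt hy)
  exact le_trans hz (monotone_cdf μ hzy.le)

theorem monotoneOn_quantileFn (μ : Measure ℝ) [IsProbabilityMeasure μ] :
    MonotoneOn (quantileFn μ) (Ioo 0 1) := fun _ hs _ ht hst =>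
  (quantileFn_le_iff μ hs _).2 (hst.trans ((quantileFn_le_iff μ ht _).1 le_rfl))

theorem aemeasurable_quantileFn (μ : Measure ℝ) [IsProbabilityMeasure μ] :
    AEMeasurable (quantileFn μ) (volume.restrict (Ioo (0 : ℝ) 1)) :=
  aemeasurable_restrict_of_monotoneOn measurableSet_Ioo (monotoneOn_quantileFn μ)

/-- The quantile function pushes the uniform measure on `(0, 1)` forward to the measure itself. -/
theorem map_quantileFn (μ : Measure ℝ) [IsProbabilityMeasure μ] :
    (volume.restrict (Ioo (0 : ℝ) 1)).map (quantileFn μ) = μ := by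
  refine Measure.ext_of_Iic _ _ fun x => ?_
  have hle : cdfFn μ x ≤ 1 := measureReal_le_one
  have hpre : quantileFn μ ⁻¹' Iic x ∩ Ioo 0 1 = Iic (cdfFn μ x) ∩ Ioo 0 1 := by
    ext t
    simp only [mem_inter_iff, mem_preimage, mem_Iic, and_congr_left_iff]
    exact fun ht => quantileFn_le_iff μ ht x
  rw [Measure.map_apply_of_aemeasurable (aemeasurable_quantileFn μ) measurableSet_Iic,
    Measure.restrict_apply' measurableSet_Ioo, hpre, ← Measure.restrict_apply' measurableSet_Ioo,
    Measure.restrict_congr_set Ioo_ae_eq_Ioc, Measure.restrict_apply' measurableSet_Ioc,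
    inter_comm, Ioc_inter_Iic, min_eq_right hle, Real.volume_Ioc, sub_zero]
  exact ENNReal.ofReal_toReal (measure_ne_top μ _)

theorem memLp_quantileFn (μ : Measure ℝ) [IsProbabilityMeasure μ]
    (hμ : Integrable (fun x : ℝ => x ^ 2) μ) :
    MemLp (quantileFn μ) 2 (volume.restrict (Ioo (0 : ℝ) 1)) := by
  rw [memLp_two_iff_integrable_sq (aemeasurable_quantileFn μ).aestronglyMeasurable]
  rw [← map_quantileFn μ] at hμ
  exact hμ.comp_aemeasurable (aemeasurable_quantileFn μ)

/-- For Borel probability measures on ℝ with finite second moments, the one-dimensional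
Wasserstein-2 distance vanishes iff the measures are equal. -/
theorem W2_eq_zero_iff (μ ν : Measure ℝ)
    [IsProbabilityMeasure μ] [IsProbabilityMeasure ν]
    (hμ : Integrable (fun x : ℝ => x ^ 2) μ) (hν : Integrable (fun x : ℝ => x ^ 2) ν) :
    W2 μ ν = 0 ↔ μ = ν := by
  refine ⟨fun h => ?_, fun h => by simp [h, W2]⟩
  have hint : IntegrableOn (fun t => (quantileFn μ t - quantileFn ν t) ^ 2) (Ioo 0 1) :=
    ((memLp_quantileFn μ hμ).sub (memLp_quantileFn ν hν)).integrable_sq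
  rw [W2, Real.sqrt_eq_zero (integral_nonneg fun t => sq_nonneg _),
    integral_eq_zero_iff_of_nonneg (fun t => sq_nonneg _) hint] at h
  rw [← map_quantileFn μ, ← map_quantileFn ν]
  refine Measure.map_congr ?_
  filter_upwards [h] with t ht
  exact sub_eq_zero.1 (pow_eq_zero_iff two_ne_zero |>.1 ht)
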